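/- arXiv:1811.06865 — 2 statements merged into one kernel-verified Lean document; each statement's English description precedes it below -/
import Mathlib

section
/- Let X be a Banach space such that every infinite-dimensional complemented subspace of X is isomorphic to its square. Then the Calkin algebra B(X)/K(X) has no minimal idempotents. -/
open Module End in
theorem aux_finite_eig {X : Type*} [NormedAddCommGroup X] [NormedSpace ℂ X]
    (T : X →L[ℂ] X) (hT : IsCompactOperator T) (δ : ℝ) (hδ : 0 < δ) :
    {μ : ℂ | HasEigenvalue (T : End ℂ X) μ ∧ δ ≤ ‖μ‖}.Finite := by
  by_contra hinf
  have hinf : Set.Infinite {μ : ℂ | HasEigenvalue (T : End ℂ X) μ ∧ δ ≤ ‖μ‖} := hinf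
  let m := hinf.natEmbedding
  let μ : ℕ → ℂ := fun n => (m n : ℂ)
  have hμinj : Function.Injective μ := Subtype.val_injective.comp m.injective
  have hμ : ∀ n, HasEigenvalue (T : End ℂ X) (μ n) ∧ δ ≤ ‖μ n‖ := fun n => (m n).2
  choose v hv using fun n => (hμ n).1.exists_hasEigenvector
  have hTv : ∀ n, T (v n) = μ n • v n := fun n => (hv n).apply_eq_smul
  have hli := eigenvectors_linearIndependent' (T : End ℂ X) μ hμinj v hv
  let M : ℕ → Submodule ℂ X := fun n => Submodule.span ℂ (v '' Set.Iio n)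
  have hvM : ∀ n, v n ∉ M n := fun n => hli.notMem_span_image (by simp)
  have hvM' : ∀ n, v n ∈ M (n + 1) := fun n => Submodule.subset_span ⟨n, by simp, rfl⟩
  have hmono : ∀ i j, i ≤ j → M i ≤ M j := fun i j h =>
    Submodule.span_mono (Set.image_mono (Set.Iio_subset_Iio h))
  have hfd : ∀ n, FiniteDimensional ℂ (M n) := fun n =>
    FiniteDimensional.span_of_finite ℂ ((Set.finite_Iio n).image v)
  have hcl : ∀ n, IsClosed (M n : Set X) := fun n => Submodule.closed_of_finiteDimensional _
  have hTM : ∀ n, ∀ x ∈ M n, T x ∈ M n := by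
    intro n
    have : M n ≤ (M n).comap (T : X →ₗ[ℂ] X) := by
      refine Submodule.span_le.2 ?_
      rintro _ ⟨i, hi, rfl⟩
      show T (v i) ∈ M n
      rw [hTv]
      exact Submodule.smul_mem _ _ (Submodule.subset_span ⟨i, hi, rfl⟩)
    exact this
  have hTM' : ∀ n, ∀ x ∈ M (n + 1), T x - μ n • x ∈ M n := by
    intro n
    have : M (n + 1) ≤ (M n).comap ((T : X →ₗ[ℂ] X) - μ n • LinearMap.id) := by
      refine Submodule.span_le.2 ?_
      rintro _ ⟨i, hi, rfl⟩
      show T (v i) - μ n • v i ∈ M n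
      rw [hTv]
      rcases Nat.lt_succ_iff_lt_or_eq.1 hi with h | rfl
      · have : v i ∈ M n := Submodule.subset_span ⟨i, h, rfl⟩
        exact Submodule.sub_mem _ (Submodule.smul_mem _ _ this) (Submodule.smul_mem _ _ this)
      · simp
    exact this
  have hy : ∀ n, ∃ y ∈ M (n + 1), ‖y‖ = 1 ∧ ∀ x ∈ M n, (1 / 2 : ℝ) ≤ ‖y - x‖ := by
    intro n
    have h₁ : IsClosed ((M n).comap (M (n + 1)).subtype : Set (M (n + 1))) :=
      (hcl n).preimage continuous_subtype_val
    have h₂ : ∃ x : M (n + 1), x ∉ (M n).comap (M (n + 1)).subtype :=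
      ⟨⟨v n, hvM' n⟩, fun h => hvM n h⟩
    obtain ⟨x, -, hx1, hx⟩ := riesz_lemma_of_lt_one h₁ h₂ (r := 1 / 2) (by norm_num)
    refine ⟨x, x.2, hx1, fun z hz => ?_⟩
    exact hx ⟨z, hmono n (n + 1) (Nat.le_succ n) hz⟩ hz
  choose y hyM hy1 hyd using hy
  have key : ∀ i j, i < j → δ / 2 ≤ ‖T (y j) - T (y i)‖ := by
    intro i j hij
    have hj0 : μ j ≠ 0 := by
      intro h
      have := (hμ j).2
      rw [h, norm_zero] at this
      linarith
    set z := (μ j)⁻¹ • (T (y i) - (T (y j) - μ j • y j)) with hz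
    have hzM : z ∈ M j := Submodule.smul_mem _ _ (Submodule.sub_mem _
      (hmono (i + 1) j hij (hTM _ _ (hyM i))) (hTM' _ _ (hyM j)))
    have e : T (y j) - T (y i) = μ j • (y j - z) := by
      rw [hz, smul_sub, smul_inv_smul₀ hj0]; abel
    rw [e, norm_smul]
    have := hyd j z hzM
    have := (hμ j).2
    nlinarith
  obtain ⟨K, hK, hK'⟩ := IsCompactOperator.image_closedBall_subset_compact (f := (T : X →ₗ[ℂ] X)) hT 1
  obtain ⟨a, -, ψ, hψ, hlim⟩ := hK.tendsto_subseq (x := fun n => T (y n))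
    (fun n ↦ hK' ⟨y n, by simp [hy1], rfl⟩)
  obtain ⟨N, hN⟩ := Metric.cauchySeq_iff.1 hlim.cauchySeq (δ / 2) (by positivity)
  have h1 := hN (N + 1) (Nat.le_succ N) N le_rfl
  have h2 := key _ _ (hψ (Nat.lt_succ_self N))
  rw [dist_eq_norm] at h1
  simp only [Function.comp] at h1
  exact absurd h1 (not_lt.2 h2)

open Metric in
theorem aux_circle_swap {E : Type*} [NormedAddCommGroup E] [NormedSpace ℂ E]
    (f : ℂ → ℂ → E) (c : ℂ) (r s : ℝ) (hr : 0 ≤ r) (hs : 0 ≤ s)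
    (hf : ContinuousOn (Function.uncurry f) (sphere c r ×ˢ sphere c s)) :
    circleIntegral (fun z => circleIntegral (fun w => f z w) c s) c r =
    circleIntegral (fun w => circleIntegral (fun z => f z w) c r) c s := by
  unfold circleIntegral
  simp_rw [← intervalIntegral.integral_smul]
  rw [MeasureTheory.intervalIntegral_intervalIntegral_swap]
  · simp_rw [smul_comm (deriv (circleMap c r) _)]
  · have hc : Continuous (Function.uncurry fun x y : ℝ => deriv (circleMap c r) x •
        deriv (circleMap c s) y • f (circleMap c r x) (circleMap c s y)) := by
      have h1 : Continuous fun p : ℝ × ℝ => f (circleMap c r p.1) (circleMap c s p.2) := by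
        have : Continuous fun p : ℝ × ℝ => (circleMap c r p.1, circleMap c s p.2) := by fun_prop
        exact hf.comp_continuous this
          (fun p => ⟨circleMap_mem_sphere c hr _, circleMap_mem_sphere c hs _⟩)
      simp only [deriv_circleMap]
      refine Continuous.smul (by fun_prop) (Continuous.smul (by fun_prop) h1)
    refine (hc.continuousOn.integrableOn_compact
      (isCompact_uIcc (a := (0 : ℝ)) (b := 2 * Real.pi) |>.prod
       (isCompact_uIcc (a := (0 : ℝ)) (b := 2 * Real.pi)))).mono_set ?_
    exact Set.prod_mono Set.uIoc_subset_uIcc Set.uIoc_subset_uIcc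

theorem aux_circle_clm {E F : Type*} [NormedAddCommGroup E] [NormedSpace ℂ E] [CompleteSpace E]
    [NormedAddCommGroup F] [NormedSpace ℂ F] [CompleteSpace F] (L : E →L[ℂ] F)
    (f : ℂ → E) (c : ℂ) (r : ℝ) (hf : CircleIntegrable f c r) :
    circleIntegral (fun z => L (f z)) c r = L (circleIntegral f c r) := by
  unfold circleIntegral
  rw [← L.intervalIntegral_comp_comm hf.out]
  simp

section
set_option linter.unusedSectionVars false
variable {A : Type*} [NormedRing A] [NormedAlgebra ℂ A] [CompleteSpace A]

theorem aux_res_mul (a : A) (z : ℂ) (hz : z ∈ resolventSet ℂ a) :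
    resolvent a z * (algebraMap ℂ A z - a) = 1 := Ring.inverse_mul_cancel _ hz

theorem aux_mul_res (a : A) (z : ℂ) (hz : z ∈ resolventSet ℂ a) :
    (algebraMap ℂ A z - a) * resolvent a z = 1 := Ring.mul_inverse_cancel _ hz

theorem aux_resolvent_identity (a : A) (z w : ℂ) (hz : z ∈ resolventSet ℂ a)
    (hw : w ∈ resolventSet ℂ a) (hzw : w - z ≠ 0) :
    resolvent a z * resolvent a w =
      (w - z)⁻¹ • resolvent a z - (w - z)⁻¹ • resolvent a w := by
  have h : resolvent a z - resolvent a w = (w - z) • (resolvent a z * resolvent a w) := by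
    calc resolvent a z - resolvent a w
        = resolvent a z * ((algebraMap ℂ A w - a) * resolvent a w)
          - (resolvent a z * (algebraMap ℂ A z - a)) * resolvent a w := by
            rw [aux_res_mul a z hz, aux_mul_res a w hw, one_mul, mul_one]
      _ = resolvent a z * (algebraMap ℂ A (w - z)) * resolvent a w := by
            rw [map_sub]; noncomm_ring
      _ = _ := by
            rw [← Algebra.commutes, mul_assoc, Algebra.smul_def]
  rw [← smul_sub, h, inv_smul_smul₀ hzw]

theorem aux_res_cont (a : A) : ContinuousOn (resolvent a : ℂ → A) (resolventSet ℂ a) :=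
  fun z hz => (spectrum.hasDerivAt_resolvent_const_left hz).continuousAt.continuousWithinAt

open Metric in
theorem aux_riesz (a : A) (c : ℂ) (r s : ℝ) (hr : 0 < r) (hrs : r < s)
    (h : ∀ z : ℂ, r ≤ dist z c → dist z c ≤ s → z ∈ resolventSet ℂ a) :
    circleIntegral (resolvent a) c r * circleIntegral (resolvent a) c r =
      (2 * Real.pi * Complex.I : ℂ) • circleIntegral (resolvent a) c r := by
  have hs : 0 < s := hr.trans hrs
  have hRr : ∀ z ∈ sphere c r, z ∈ resolventSet ℂ a := fun z hz =>
    h z (by rw [mem_sphere.1 hz]) (by rw [mem_sphere.1 hz]; exact hrs.le)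
  have hRs : ∀ z ∈ sphere c s, z ∈ resolventSet ℂ a := fun z hz =>
    h z (by rw [mem_sphere.1 hz]; exact hrs.le) (by rw [mem_sphere.1 hz])
  have hne : ∀ z ∈ sphere c r, ∀ w ∈ sphere c s, w - z ≠ 0 := by
    intro z hz w hw h0
    rw [sub_eq_zero] at h0
    subst h0
    rw [mem_sphere] at hz hw
    linarith
  have cr : ContinuousOn (resolvent a : ℂ → A) (sphere c r) := (aux_res_cont a).mono hRr
  have cs : ContinuousOn (resolvent a : ℂ → A) (sphere c s) := (aux_res_cont a).mono hRs
  have ir : CircleIntegrable (resolvent a : ℂ → A) c r := cr.circleIntegrable hr.le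
  have is : CircleIntegrable (resolvent a : ℂ → A) c s := cs.circleIntegrable hs.le
  have heq : circleIntegral (resolvent a) c s = circleIntegral (resolvent a) c r := by
    refine Complex.circleIntegral_eq_of_differentiable_on_annulus_off_countable hr hrs.le
      Set.countable_empty ?_ ?_
    · refine (aux_res_cont a).mono fun z hz => h z ?_ ?_
      · simpa using hz.2
      · simpa using hz.1
    · intro z hz
      refine (spectrum.hasDerivAt_resolvent_const_left (h z ?_ ?_)).differentiableAt
      · have := hz.1.2
        simp only [mem_closedBall, not_le] at this
        exact this.le
      · exact (mem_ball.1 hz.1.1).le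
  have cinv : ContinuousOn (fun p : ℂ × ℂ => (p.2 - p.1)⁻¹) (sphere c r ×ˢ sphere c s) :=
    ContinuousOn.inv₀ (by fun_prop) (fun p hp => hne _ hp.1 _ hp.2)
  have e1 : ∀ z ∈ sphere c r, resolvent a z * circleIntegral (resolvent a) c s =
      (2 * Real.pi * Complex.I : ℂ) • resolvent a z
        - circleIntegral (fun w => (w - z)⁻¹ • resolvent a w) c s := by
    intro z hz
    have ci : ContinuousOn (fun w : ℂ => (w - z)⁻¹) (sphere c s) :=
      ContinuousOn.inv₀ (by fun_prop) (fun w hw => hne _ hz _ hw)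
    rw [← circleIntegral.integral_sub_inv_of_mem_ball (c := c) (R := s) (w := z)
      (by rw [mem_ball, mem_sphere.1 hz]; exact hrs),
      ← circleIntegral.integral_smul_const, ← circleIntegral.integral_sub]
    · have := aux_circle_clm (ContinuousLinearMap.mul ℂ A (resolvent a z)) (resolvent a) c s is
      simp only [ContinuousLinearMap.mul_apply'] at this
      rw [← this]
      refine circleIntegral.integral_congr hs.le fun w hw => ?_
      exact aux_resolvent_identity a z w (hRr z hz) (hRs w hw) (hne z hz w hw)
    · exact (ci.smul continuousOn_const).circleIntegrable hs.le
    · exact (ci.smul cs).circleIntegrable hs.le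
  have csm : ContinuousOn (Function.uncurry fun z w : ℂ => (w - z)⁻¹ • resolvent a w)
      (sphere c r ×ˢ sphere c s) :=
    cinv.smul (cs.comp continuousOn_snd fun p hp => hp.2)
  have e2 : circleIntegral (fun z => circleIntegral (fun w => (w - z)⁻¹ • resolvent a w) c s) c r
      = 0 := by
    rw [aux_circle_swap (fun z w => (w - z)⁻¹ • resolvent a w) c r s hr.le hs.le csm]
    have : ∀ w ∈ sphere c s, circleIntegral (fun z => (w - z)⁻¹ • resolvent a w) c r = 0 := by
      intro w hw
      have hn : ∀ z ∈ closedBall c r, w - z ≠ 0 := by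
        intro z hz h0
        rw [sub_eq_zero] at h0
        subst h0
        rw [mem_sphere] at hw
        rw [mem_closedBall] at hz
        linarith
      rw [circleIntegral.integral_smul_const,
        Complex.circleIntegral_eq_zero_of_differentiable_on_off_countable hr.le
          Set.countable_empty, zero_smul]
      · exact ContinuousOn.inv₀ (by fun_prop) hn
      · intro z hz
        exact DifferentiableAt.inv (by fun_prop) (hn z (ball_subset_closedBall hz.1))
    rw [circleIntegral.integral_congr hs.le (g := fun _ => 0) this]
    simp [circleIntegral]
  have e3 : circleIntegral (resolvent a) c r * circleIntegral (resolvent a) c s =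
      circleIntegral (fun z => resolvent a z * circleIntegral (resolvent a) c s) c r := by
    have := aux_circle_clm ((ContinuousLinearMap.mul ℂ A).flip (circleIntegral (resolvent a) c s))
      (resolvent a) c r ir
    simp only [ContinuousLinearMap.mul_apply', ContinuousLinearMap.flip_apply] at this
    exact this.symm
  have cc : CircleIntegrable (fun z => circleIntegral (fun w => (w - z)⁻¹ • resolvent a w) c s)
      c r := by
    have : ContinuousOn (fun z => (2 * Real.pi * Complex.I : ℂ) • resolvent a z
        - resolvent a z * circleIntegral (resolvent a) c s) (sphere c r) :=
      (continuousOn_const.smul cr).sub (cr.mul continuousOn_const)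
    refine ContinuousOn.circleIntegrable hr.le (this.congr fun z hz => ?_)
    simp only [e1 z hz]
    abel
  nth_rewrite 2 [← heq]
  rw [e3, circleIntegral.integral_congr hr.le e1, circleIntegral.integral_sub _ cc, e2, sub_zero,
    circleIntegral.integral_smul]
  exact (continuousOn_const.smul cr).circleIntegrable hr.le
end

open Module End in
theorem aux_annulus {X : Type*} [NormedAddCommGroup X] [NormedSpace ℂ X] [CompleteSpace X]
    (e : X →L[ℂ] X) (he : IsCompactOperator ⇑(e * e - e)) :
    ∃ r s : ℝ, 1 / 4 < r ∧ r < s ∧ s < 1 / 2 ∧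
      ∀ z : ℂ, r ≤ dist z 1 → dist z 1 ≤ s → z ∈ resolventSet ℂ e := by
  have hS := aux_finite_eig (e * e - e) he (1 / 8) (by norm_num)
  set S := {μ : ℂ | HasEigenvalue ((e * e - e : X →L[ℂ] X) : End ℂ X) μ ∧ 1 / 8 ≤ ‖μ‖} with hSdef
  have hS' : {z : ℂ | z * z - z ∈ S}.Finite := by
    refine Set.Finite.preimage' (f := fun z : ℂ => z * z - z) hS fun w _ => ?_
    by_cases hne : ∃ z0 : ℂ, z0 * z0 - z0 = w
    · obtain ⟨z0, hz0⟩ := hne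
      refine (Set.toFinite {z0, 1 - z0}).subset fun z hz => ?_
      have hz : z * z - z = w := hz
      have : (z - z0) * (z - (1 - z0)) = 0 := by linear_combination hz - hz0
      rcases mul_eq_zero.1 this with h | h
      · left; exact sub_eq_zero.1 h
      · right; exact sub_eq_zero.1 h
    · refine Set.Finite.subset Set.finite_empty fun z hz => ?_
      exact hne ⟨z, hz⟩
  set B := (fun z : ℂ => dist z 1) '' {z : ℂ | z * z - z ∈ S} with hB
  have hBf : B.Finite := hS'.image _
  obtain ⟨ρ, hρ⟩ : (Set.Ioo (1 / 4 : ℝ) (1 / 2) \ B).Nonempty :=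
    ((Set.Ioo_infinite (by norm_num)).sdiff hBf).nonempty
  have hop : IsOpen (Set.Ioo (1 / 4 : ℝ) (1 / 2) \ B) := isOpen_Ioo.sdiff hBf.isClosed
  obtain ⟨ε, hε, hsub⟩ := Metric.nhds_basis_closedBall.mem_iff.1 (hop.mem_nhds hρ)
  rw [Real.closedBall_eq_Icc] at hsub
  have h1 := hsub (Set.left_mem_Icc.2 (by linarith))
  have h2 := hsub (Set.right_mem_Icc.2 (by linarith))
  refine ⟨ρ - ε, ρ + ε, h1.1.1, by linarith, h2.1.2, fun z hz1 hz2 => ?_⟩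
  have hz := hsub ⟨hz1, hz2⟩
  have hzS : z * z - z ∉ S := fun h => hz.2 ⟨z, h, rfl⟩
  have hd1 : 1 / 4 < ‖z - 1‖ := by rw [← dist_eq_norm]; exact hz.1.1
  have hd2 : ‖z - 1‖ < 1 / 2 := by rw [← dist_eq_norm]; exact hz.1.2
  have hd3 : 1 / 2 ≤ ‖z‖ := by
    have := norm_sub_norm_le (1 : ℂ) (1 - z)
    rw [norm_one, norm_sub_rev 1 z, sub_sub_cancel] at this
    linarith
  have hw : 1 / 8 ≤ ‖z * z - z‖ := by
    rw [show z * z - z = z * (z - 1) by ring, norm_mul]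
    nlinarith
  have hw0 : z * z - z ≠ 0 := by
    intro h; rw [h, norm_zero] at hw; norm_num at hw
  have hres : z * z - z ∈ resolventSet ℂ (e * e - e) :=
    (he.hasEigenvalue_or_mem_resolventSet hw0).resolve_left fun h => hzS ⟨h, hw⟩
  rw [spectrum.mem_resolventSet_iff] at hres ⊢
  set Z := algebraMap ℂ (X →L[ℂ] X) z with hZ
  have hc : Z * e = e * Z := Algebra.commutes z e
  have hfac : algebraMap ℂ (X →L[ℂ] X) (z * z - z) - (e * e - e) = (Z - e) * (Z - 1 + e) := by
    rw [map_sub, map_mul, ← hZ]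
    have : (Z - e) * (Z - 1 + e) = Z * Z - Z + (Z * e - e * Z) - (e * e - e) := by noncomm_ring
    rw [this, hc]; abel
  have hcomm : Commute (Z - e) (Z - 1 + e) := by
    show (Z - e) * (Z - 1 + e) = (Z - 1 + e) * (Z - e)
    have : (Z - e) * (Z - 1 + e) - (Z - 1 + e) * (Z - e) = (Z * e - e * Z) + (Z * e - e * Z) := by
      noncomm_ring
    rw [hc, sub_self, add_zero] at this
    exact sub_eq_zero.1 this
  rw [hfac] at hres
  exact (hcomm.isUnit_mul_iff.1 hres).1

theorem aux_lift {X : Type*} [NormedAddCommGroup X] [NormedSpace ℂ X] [CompleteSpace X]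
    (e : X →L[ℂ] X) (he : IsCompactOperator ⇑(e * e - e)) :
    ∃ P : X →L[ℂ] X, P * P = P ∧ IsCompactOperator ⇑(P - e) := by
  obtain ⟨r, s, hr, hrs, hs, h⟩ := aux_annulus e he
  have hr0 : 0 < r := by linarith
  have h2 : (2 * Real.pi * Complex.I : ℂ) ≠ 0 := Complex.two_pi_I_ne_zero
  have hR : ∀ z ∈ Metric.sphere (1 : ℂ) r, z ∈ resolventSet ℂ e := fun z hz =>
    h z (by rw [Metric.mem_sphere.1 hz]) (by rw [Metric.mem_sphere.1 hz]; exact hrs.le)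
  have cr : ContinuousOn (resolvent e : ℂ → (X →L[ℂ] X)) (Metric.sphere 1 r) :=
    (aux_res_cont e).mono hR
  set c := e * e - e with hc
  have hz0 : ∀ z ∈ Metric.closedBall (1 : ℂ) r, z ≠ 0 := by
    rintro z hz rfl
    rw [Metric.mem_closedBall, dist_comm, dist_zero_right, norm_one] at hz
    linarith
  have hz1 : ∀ z ∈ Metric.sphere (1 : ℂ) r, z - 1 ≠ 0 := by
    intro z hz h0
    rw [sub_eq_zero] at h0
    subst h0
    rw [Metric.mem_sphere, dist_self] at hz
    linarith
  have hss := Metric.sphere_subset_closedBall (x := (1 : ℂ)) (ε := r)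
  have ci0 : ContinuousOn (fun z : ℂ => z⁻¹) (Metric.sphere 1 r) :=
    continuousOn_id.inv₀ fun z hz => hz0 z (hss hz)
  have ci1 : ContinuousOn (fun z : ℂ => (z - 1)⁻¹) (Metric.sphere 1 r) :=
    ContinuousOn.inv₀ (by fun_prop) hz1
  set G : ℂ → (X →L[ℂ] X) := fun z => ((z - 1)⁻¹ - z⁻¹) • resolvent e z with hG
  have cG : ContinuousOn G (Metric.sphere 1 r) := (ci1.sub ci0).smul cr
  have key : ∀ z ∈ Metric.sphere (1 : ℂ) r, resolvent e z =
      ((z - 1)⁻¹ • e + z⁻¹ • (1 - e)) + G z * c := by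
    intro z hz
    have a0 := hz0 z (hss hz)
    have a1 := hz1 z hz
    set Z := algebraMap ℂ (X →L[ℂ] X) z with hZ
    have hl := aux_res_mul e z (hR z hz)
    have q : (Z - e) * ((z - 1)⁻¹ • e + z⁻¹ • (1 - e)) = 1 - ((z - 1)⁻¹ - z⁻¹) • c := by
      rw [hZ, Algebra.algebraMap_eq_smul_one, hc]
      simp only [sub_mul, mul_add, mul_sub, smul_mul_assoc, one_mul, mul_one, mul_smul_comm,
        smul_sub, smul_smul]
      match_scalars <;> field_simp <;> ring
    have q2 := congrArg (fun t => resolvent e z * t) q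
    simp only [← mul_assoc] at q2
    rw [hl, one_mul, mul_sub, mul_one, mul_smul_comm] at q2
    rw [q2, hG]
    simp only [smul_mul_assoc]
    abel
  set J := circleIntegral (resolvent e) 1 r with hJ
  have hJval : J = (2 * Real.pi * Complex.I : ℂ) • e + circleIntegral G 1 r * c := by
    have i1 : CircleIntegrable (fun z : ℂ => (z - 1)⁻¹ • e) 1 r :=
      (ci1.smul continuousOn_const).circleIntegrable hr0.le
    have i2 : CircleIntegrable (fun z : ℂ => z⁻¹ • (1 - e)) 1 r :=
      (ci0.smul continuousOn_const).circleIntegrable hr0.le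
    have i12 : CircleIntegrable (fun z : ℂ => (z - 1)⁻¹ • e + z⁻¹ • (1 - e)) 1 r := i1.add i2
    have i3 : CircleIntegrable (fun z : ℂ => G z * c) 1 r :=
      (cG.mul continuousOn_const).circleIntegrable hr0.le
    have v2 : circleIntegral (fun z : ℂ => z⁻¹) 1 r = 0 := by
      refine Complex.circleIntegral_eq_zero_of_differentiable_on_off_countable hr0.le
        Set.countable_empty (continuousOn_id.inv₀ hz0) ?_
      intro z hz
      exact differentiableAt_inv (hz0 z (Metric.ball_subset_closedBall hz.1))
    have v3 := aux_circle_clm ((ContinuousLinearMap.mul ℂ (X →L[ℂ] X)).flip c) G 1 r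
      (cG.circleIntegrable hr0.le)
    simp only [ContinuousLinearMap.mul_apply', ContinuousLinearMap.flip_apply] at v3
    rw [hJ, circleIntegral.integral_congr hr0.le key, circleIntegral.integral_add i12 i3,
      circleIntegral.integral_add i1 i2, circleIntegral.integral_smul_const,
      circleIntegral.integral_smul_const, v2, circleIntegral.integral_sub_center_inv 1 hr0.ne', v3,
      zero_smul, add_zero]
  have hJJ := aux_riesz e 1 r s hr0 hrs h
  rw [← hJ] at hJJ
  refine ⟨(2 * Real.pi * Complex.I : ℂ)⁻¹ • J, ?_, ?_⟩
  · rw [smul_mul_smul_comm, hJJ, smul_smul, mul_assoc, inv_mul_cancel₀ h2, mul_one]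
  · rw [hJval, smul_add, inv_smul_smul₀ h2, add_sub_cancel_left]
    have := (he.clm_comp (circleIntegral G 1 r)).smul (2 * Real.pi * Complex.I : ℂ)⁻¹
    exact this


/-- If every infinite-dimensional complemented subspace of the Banach space
`X` is isomorphic to its square, then the Calkin algebra `B(X)/K(X)` has no minimal
idempotents. Formally (via representatives): there is no `e : B(X)` whose class modulo the
compact operators is a nonzero idempotent that is minimal among nonzero idempotent classes. -/
theorem calkin_no_minimal_idempotents
    {X : Type*} [NormedAddCommGroup X] [NormedSpace ℂ X] [CompleteSpace X]
    (hX : ∀ P : X →L[ℂ] X, P * P = P →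
      ¬ FiniteDimensional ℂ (LinearMap.range (P : X →ₗ[ℂ] X)) →
      Nonempty ((LinearMap.range (P : X →ₗ[ℂ] X)) ≃L[ℂ]
        ((LinearMap.range (P : X →ₗ[ℂ] X)) × (LinearMap.range (P : X →ₗ[ℂ] X))))) :
    ¬ ∃ e : X →L[ℂ] X,
        IsCompactOperator ⇑(e * e - e) ∧ ¬ IsCompactOperator ⇑e ∧
        ∀ f : X →L[ℂ] X, IsCompactOperator ⇑(f * f - f) → ¬ IsCompactOperator ⇑f →
          IsCompactOperator ⇑(e * f - f) → IsCompactOperator ⇑(f * e - f) →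
          IsCompactOperator ⇑(f - e) := by
  rintro ⟨e, he, hne, hmin⟩
  obtain ⟨P, hPP, hPe⟩ := aux_lift e he
  have hPx : ∀ x, P (P x) = P x := fun x => by
    have := congrArg (fun T : X →L[ℂ] X => T x) hPP
    exact this
  set R := LinearMap.range (P : X →ₗ[ℂ] X) with hR
  have hRfix : ∀ x : R, P (x : X) = x := by
    rintro ⟨_, y, rfl⟩
    exact hPx y
  let p : X →L[ℂ] R := P.codRestrict R (fun x => ⟨x, rfl⟩)
  have hpval : ∀ x, ((p x : R) : X) = P x := fun x => rfl
  have hpR : ∀ x : R, p (x : X) = x := fun x => Subtype.ext (hRfix x)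
  let i : R →L[ℂ] X := R.subtypeL
  have hinf : ¬ FiniteDimensional ℂ R := by
    intro hfd
    have : IsCompactOperator (p : X → R) := by
      have : ProperSpace R := FiniteDimensional.proper ℂ R
      have h1 : IsCompactOperator (id : R → R) := isCompactOperator_id
      exact h1.comp_clm p
    have hP : IsCompactOperator (P : X → X) := this.clm_comp i
    have := hP.sub hPe
    refine hne ?_
    refine Eq.mp (congrArg (fun g : X → X => IsCompactOperator g) ?_) this
    funext x; simp
  obtain ⟨Φ⟩ := hX P hPP hinf
  have noid : ¬ IsCompactOperator (id : R → R) := fun h =>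
    hinf (FiniteDimensional.of_isCompactOperator_id h)
  let Q : X →L[ℂ] X := i.comp ((Φ.symm : (R × R) →L[ℂ] R).comp
    ((ContinuousLinearMap.inl ℂ R R).comp ((ContinuousLinearMap.fst ℂ R R).comp
      ((Φ : R →L[ℂ] (R × R)).comp p))))
  have hQ : ∀ x, Q x = (Φ.symm ((Φ (p x)).1, 0) : R) := fun x => rfl
  have hPQ : P * Q = Q := by
    ext x
    show P (Q x) = Q x
    rw [hQ, hRfix]
  have hQP : Q * P = Q := by
    ext x
    show Q (P x) = Q x
    rw [hQ, hQ, ← hpval, hpR]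
  have hQQ : Q * Q = Q := by
    ext x
    show Q (Q x) = Q x
    rw [hQ, hQ, hpR]
    simp
  have hQn : ¬ IsCompactOperator (Q : X → X) := by
    intro hc
    apply noid
    have h1 := (hc.comp_clm (i.comp ((Φ.symm : (R × R) →L[ℂ] R).comp
      (ContinuousLinearMap.inl ℂ R R)))).clm_comp
      ((ContinuousLinearMap.fst ℂ R R).comp ((Φ : R →L[ℂ] (R × R)).comp p))
    refine Eq.mp (congrArg (fun g : R → R => IsCompactOperator g) ?_) h1
    funext x
    show (Φ (p (Q ((Φ.symm (x, 0) : R) : X)))).1 = x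
    rw [hQ, hpR, hpR]
    simp
  have hPQn : ¬ IsCompactOperator ⇑(Q - P) := by
    intro hc
    apply noid
    have h1 := ((hc.comp_clm (i.comp ((Φ.symm : (R × R) →L[ℂ] R).comp
      (ContinuousLinearMap.inr ℂ R R)))).clm_comp
      ((ContinuousLinearMap.snd ℂ R R).comp ((Φ : R →L[ℂ] (R × R)).comp p))).neg
    refine Eq.mp (congrArg (fun g : R → R => IsCompactOperator g) ?_) h1
    funext x
    show -(Φ (p (Q ((Φ.symm (0, x) : R) : X) - P ((Φ.symm (0, x) : R) : X)))).2 = x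
    rw [hQ, hRfix, map_sub, hpR, hpR]
    simp
  have hfin : IsCompactOperator ⇑(Q - e) := by
    refine hmin Q ?_ hQn ?_ ?_
    · rw [hQQ, sub_self]
      exact isCompactOperator_zero
    · have h1 : e * Q - Q = -((P - e) * Q) := by rw [sub_mul, hPQ]; abel
      rw [h1]
      exact (hPe.comp_clm Q).neg
    · have h1 : Q * e - Q = -(Q * (P - e)) := by rw [mul_sub, hQP]; abel
      rw [h1]
      exact (hPe.clm_comp Q).neg
  apply hPQn
  have h1 : Q - P = (Q - e) - (P - e) := by abel
  rw [h1]
  exact hfin.sub hPe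
end

section
/- Let H be a complex Hilbert space and J a nonzero closed two-sided ideal of B(H). Then the quotient Banach algebra B(H)/J has no minimal idempotents. -/
theorem qBH_mul_apply {H : Type*} [NormedAddCommGroup H] [InnerProductSpace ℂ H]
    (f g : H →L[ℂ] H) (z : H) : (f * g) z = f (g z) := rfl

open ContinuousLinearMap in
/-- Spectral-type splitting: a closed subspace on which `x` is bounded below, while `x` is small on
the orthogonal complement. -/
theorem qBH_split {H : Type*} [NormedAddCommGroup H] [InnerProductSpace ℂ H] [CompleteSpace H]
    (x : H →L[ℂ] H) (ε : ℝ) :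
    ∃ K : Submodule ℂ H, IsClosed (K : Set H) ∧ (∀ k ∈ K, ε * ‖k‖ ^ 2 ≤ ‖x k‖ ^ 2) ∧
      (∀ k ∈ Kᗮ, ‖x k‖ ^ 2 ≤ ε * ‖k‖ ^ 2) := by
  set a : H →L[ℂ] H := star x * x - (ε : ℂ) • 1 with ha
  have hsa : IsSelfAdjoint a := by
    refine (IsSelfAdjoint.star_mul_self x).sub ?_
    rw [isSelfAdjoint_iff, star_smul]
    simp
  have h1 : a⁺ - a⁻ = a := CFC.posPart_sub_negPart a hsa
  have h2 : a⁺ * a⁻ = 0 := CFC.posPart_mul_negPart a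
  have h2' : a⁻ * a⁺ = 0 := CFC.negPart_mul_posPart a
  have hp : (a⁺).IsPositive := (nonneg_iff_isPositive _).1 (CFC.posPart_nonneg a)
  have hn : (a⁻).IsPositive := (nonneg_iff_isPositive _).1 (CFC.negPart_nonneg a)
  have hq : ∀ k, (inner ℂ (a k) k).re = ‖x k‖ ^ 2 - ε * ‖k‖ ^ 2 := by
    intro k
    have e1 : inner ℂ ((star x * x) k) k = ((‖x k‖ ^ 2 : ℝ) : ℂ) := by
      rw [star_eq_adjoint, qBH_mul_apply, adjoint_inner_left, inner_self_eq_norm_sq_to_K]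
      simp
    have e2 : inner ℂ (((ε : ℂ) • (1 : H →L[ℂ] H)) k) k = ((ε * ‖k‖ ^ 2 : ℝ) : ℂ) := by
      simp [inner_smul_left, inner_self_eq_norm_sq_to_K]
    rw [ha, sub_apply, inner_sub_left, e1, e2, ← Complex.ofReal_sub, Complex.ofReal_re]
  refine ⟨(a⁻).ker, (a⁻).isClosed_ker, ?_, ?_⟩
  · intro k hk
    have hk0 : a⁻ k = 0 := hk
    have : a k = a⁺ k := by
      conv_lhs => rw [← h1]
      simp [hk0]
    have h3 := hq k
    rw [this] at h3
    have h4 : 0 ≤ (inner ℂ (a⁺ k) k).re := hp.re_inner_nonneg_left k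
    linarith
  · intro k hk
    have hz : a⁺ k = 0 := by
      have h5 : a⁺ (a⁺ k) ∈ (a⁻).ker := by
        change (a⁻ * a⁺) (a⁺ k) = 0
        rw [h2']; simp
      have h6 : inner ℂ (a⁺ (a⁺ k)) k = 0 := Submodule.inner_right_of_mem_orthogonal h5 hk
      have h7 : inner ℂ (a⁺ (a⁺ k)) k = inner ℂ (a⁺ k) (a⁺ k) := hp.isSymmetric _ _
      rw [h7] at h6
      exact inner_self_eq_zero.1 h6
    have : a k = - a⁻ k := by
      conv_lhs => rw [← h1]
      simp [hz]
    have h3 := hq k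
    rw [this, inner_neg_left] at h3
    have h4 : 0 ≤ (inner ℂ (a⁻ k) k).re := hn.re_inner_nonneg_left k
    rw [Complex.neg_re] at h3
    linarith

/-- An infinite-dimensional Hilbert space has two isometries with orthogonal ranges. -/
theorem qBH_isometries {K : Type*} [NormedAddCommGroup K] [InnerProductSpace ℂ K] [CompleteSpace K]
    (hK : ¬ FiniteDimensional ℂ K) :
    ∃ u v : K →ₗᵢ[ℂ] K, ∀ a b, inner ℂ (u a) (v b) = 0 := by
  obtain ⟨w, b, hb⟩ := exists_hilbertBasis ℂ K
  have hw : Infinite w := by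
    by_contra h
    rw [not_infinite_iff_finite] at h
    have := Fintype.ofFinite w
    exact hK (Module.Basis.finiteDimensional_of_finite b.toOrthonormalBasis.toBasis)
  obtain ⟨φ⟩ : Nonempty (w ⊕ w ≃ w) := by
    rw [← Cardinal.eq]
    simp
  have o1 : Orthonormal ℂ (fun i => b (φ (Sum.inl i))) :=
    b.orthonormal.comp _ (φ.injective.comp Sum.inl_injective)
  have o2 : Orthonormal ℂ (fun i => b (φ (Sum.inr i))) :=
    b.orthonormal.comp _ (φ.injective.comp Sum.inr_injective)
  refine ⟨o1.orthogonalFamily.linearIsometry.comp b.repr.toLinearIsometry,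
    o2.orthogonalFamily.linearIsometry.comp b.repr.toLinearIsometry, fun x y => ?_⟩
  have s1 := o1.orthogonalFamily.hasSum_linearIsometry (b.repr x)
  have s2 := o2.orthogonalFamily.hasSum_linearIsometry (b.repr y)
  have z : ∀ i, inner ℂ (b (φ (Sum.inl i)))
      (o2.orthogonalFamily.linearIsometry (b.repr y)) = 0 := by
    intro i
    refine (s2.mapL (innerSL ℂ (b (φ (Sum.inl i))))).unique ?_
    convert hasSum_zero with j
    have := b.orthonormal.2 (i := φ (Sum.inl i)) (j := φ (Sum.inr j)) (by simp)
    simp [this]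
  rw [← inner_conj_symm, starRingEnd_apply, star_eq_zero]
  refine (s1.mapL (innerSL ℂ (o2.orthogonalFamily.linearIsometry (b.repr y)))).unique ?_
  convert hasSum_zero with j
  have := z j
  rw [← inner_conj_symm, starRingEnd_apply, star_eq_zero] at this
  simp [this]

open ContinuousLinearMap in
theorem qBH_leftInverse {K H : Type*} [NormedAddCommGroup H] [InnerProductSpace ℂ H]
    [CompleteSpace H] [NormedAddCommGroup K] [InnerProductSpace ℂ K] [CompleteSpace K]
    (A : K →L[ℂ] H) (ε : ℝ) (hε : 0 < ε) (h : ∀ k, ε * ‖k‖ ^ 2 ≤ ‖A k‖ ^ 2) :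
    ∃ y : H →L[ℂ] K, ∀ k, y (A k) = k := by
  have hA : AntilipschitzWith (Real.toNNReal (√ε)⁻¹) A := by
    refine A.antilipschitz_of_bound fun k => ?_
    have hs : 0 < √ε := Real.sqrt_pos.2 hε
    rw [Real.coe_toNNReal _ (by positivity), inv_mul_eq_div, le_div_iff₀ hs]
    refine le_of_sq_le_sq ?_ (norm_nonneg _) 
    rw [mul_pow, Real.sq_sqrt hε.le, mul_comm]
    exact h k
  have hcl : IsClosed (Set.range A) := hA.isClosed_range A.uniformContinuous
  have : CompleteSpace A.range := hcl.completeSpace_coe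
  refine ⟨(A.equivRange hA.injective hcl).symm.toContinuousLinearMap ∘L
    A.range.orthogonalProjectionOnto, fun k => ?_⟩
  have : A.range.orthogonalProjectionOnto (A k) = A.equivRange hA.injective hcl k := by
    have := A.range.orthogonalProjectionOnto_mem_subspace_eq_self ⟨A k, A.mem_range_self k⟩
    rw [this]; rfl
  change (A.equivRange hA.injective hcl).symm (A.range.orthogonalProjectionOnto (A k)) = k
  rw [this, ContinuousLinearEquiv.symm_apply_apply]

open InnerProductSpace in
theorem qBH_finite {H : Type*} [NormedAddCommGroup H] [InnerProductSpace ℂ H] [CompleteSpace H]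
    (J : TwoSidedIdeal (H →L[ℂ] H)) (hJ0 : J ≠ ⊥) (K : Submodule ℂ H) [FiniteDimensional ℂ K] :
    K.starProjection ∈ J := by
  obtain ⟨x, hx, hx0⟩ : ∃ x ∈ J, x ≠ 0 := by
    by_contra! h
    refine hJ0 (TwoSidedIdeal.ext fun x => ?_)
    rw [TwoSidedIdeal.mem_bot]
    exact ⟨h x, fun h => h ▸ J.zero_mem⟩
  obtain ⟨v, hv⟩ : ∃ v, x v ≠ 0 := by
    by_contra! h
    exact hx0 (ContinuousLinearMap.ext h)
  have hr : ∀ a b : H, rankOne ℂ a b ∈ J := by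
    intro a b
    have : rankOne ℂ a b = (rankOne ℂ ((inner ℂ (x v) (x v))⁻¹ • a) (x v)) * (x * rankOne ℂ v b) := by
      ext z
      have : inner ℂ (x v) (x v) ≠ 0 := by simpa using hv
      simp only [qBH_mul_apply, rankOne_apply, x.map_smul, smul_smul, inner_smul_right]
      rw [mul_assoc, mul_inv_cancel₀ this, mul_one]
    rw [this]
    exact J.mul_mem_left _ _ (J.mul_mem_right _ _ hx)
  rw [(stdOrthonormalBasis ℂ K).starProjection_eq_sum_rankOne]
  exact sum_mem fun i _ => hr _ _

/-- The purely algebraic part. -/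
theorem qBH_algebra {R : Type*} [Ring R] (J : TwoSidedIdeal R) (e y p q : R)
    (he : e * e - e ∈ J) (he0 : e ∉ J)
    (hmin : ∀ f : R, f * f - f ∈ J → f ∉ J → e * f - f ∈ J → f * e - f ∈ J → f - e ∈ J)
    (hp : y * e * p = p) (hq : y * e * q = q) (hpp : p * p = p) (hqq : q * q = q)
    (hpq : p * q = 0) (hpJ : p ∉ J) (hqJ : q ∉ J) : False := by
  have key : ∀ p : R, y * e * p = p → p * p = p → p ∉ J → e * p * y * e - e ∈ J := by
    intro p hp hpp hpJ
    apply hmin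
    · have h := J.mul_mem_left (e * p * y) _ (J.mul_mem_right _ (p * y * e) he)
      convert h using 1
      have : e * p * y * ((e * e - e) * (p * y * e)) =
        e * p * y * e * (e * p * y * e) - e * p * (y * e * p) * y * e := by noncomm_ring
      rw [this, hp, mul_assoc e p p, hpp]
    · intro h
      apply hpJ
      have h := J.mul_mem_left y _ (J.mul_mem_right _ p h)
      have h3 : y * (e * p * y * e * p) = (y * e * p) * (y * e * p) := by noncomm_ring
      rwa [h3, hp, hpp] at h
    · convert J.mul_mem_right _ (p * y * e) he using 1
      noncomm_ring
    · convert J.mul_mem_left (e * p * y) _ he using 1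
      noncomm_ring
  have k1 := key p hp hpp hpJ
  have k2 := key q hq hqq hqJ
  have m1 := J.mul_mem_left (e * p * y) _ (J.mul_mem_right _ (q * y * e) he)
  have e1 : e * p * y * ((e * e - e) * (q * y * e)) =
      e * p * y * e * (e * q * y * e) - e * p * (y * e * q) * y * e := by noncomm_ring
  rw [e1, hq, mul_assoc e p q, hpq] at m1
  have m2 := J.mul_mem_right _ (e * q * y * e) k1
  have m3 := J.mul_mem_left e _ k2
  apply he0
  have : e = (e * p * y * e * (e * q * y * e) - e * 0 * y * e)
    - (e * p * y * e - e) * (e * q * y * e) - e * (e * q * y * e - e) - (e * e - e) := by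
    noncomm_ring
  rw [this]
  exact J.sub_mem (J.sub_mem (J.sub_mem m1 m2) m3) he

open ContinuousLinearMap in
/-- Let `H` be a complex Hilbert space and `J` a nonzero closed two-sided
ideal of `B(H)`. Then the quotient `B(H)/J` has no minimal idempotents. Formally (via
representatives): there is no `e : B(H)` whose class modulo `J` is a nonzero idempotent that
is minimal among the nonzero idempotent classes. -/
theorem quotient_of_BH_no_minimal_idempotents
    {H : Type*} [NormedAddCommGroup H] [InnerProductSpace ℂ H] [CompleteSpace H]
    (J : TwoSidedIdeal (H →L[ℂ] H)) (hJ0 : J ≠ ⊥)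
    (hJc : IsClosed (J : Set (H →L[ℂ] H))) :
    ¬ ∃ e : H →L[ℂ] H,
        e * e - e ∈ J ∧ e ∉ J ∧
        ∀ f : H →L[ℂ] H, f * f - f ∈ J → f ∉ J →
          e * f - f ∈ J → f * e - f ∈ J → f - e ∈ J := by
  rintro ⟨e, he, he0, hmin⟩
  obtain ⟨δ, hδ, hball⟩ : ∃ δ > 0, ∀ z ∈ J, δ ≤ ‖e - z‖ := by
    have : (J : Set (H →L[ℂ] H))ᶜ ∈ nhds e := hJc.isOpen_compl.mem_nhds he0
    obtain ⟨δ, hδ, hb⟩ := Metric.mem_nhds_iff.1 this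
    refine ⟨δ, hδ, fun z hz => ?_⟩
    by_contra! h
    refine hb (a := z) ?_ hz
    rw [Metric.mem_ball, dist_comm, dist_eq_norm]
    exact h
  have hε : 0 < (δ / 2) ^ 2 := by positivity
  obtain ⟨K, hKc, hK1, hK2⟩ := qBH_split e ((δ / 2) ^ 2)
  have : CompleteSpace K := hKc.completeSpace_coe
  have hPJ : K.starProjection ∉ J := by
    intro hP
    have h1 := hball _ (J.mul_mem_left e _ hP)
    have h2 : ‖e - e * K.starProjection‖ ≤ δ / 2 := by
      refine opNorm_le_bound _ (by positivity) fun z => ?_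
      have hz : z - K.starProjection z ∈ Kᗮ := K.sub_starProjection_mem_orthogonal z
      have h3 := hK2 _ hz
      have h4 : ‖z - K.starProjection z‖ ≤ ‖z‖ := by
        have h5 := K.norm_sq_eq_add_norm_sq_projection z
        have h6 := Kᗮ.norm_starProjection_apply_le z
        rwa [K.starProjection_orthogonal_val] at h6
      have h7 : (e - e * K.starProjection) z = e (z - K.starProjection z) := by simp
      rw [h7]
      rw [← mul_pow] at h3
      refine (le_of_sq_le_sq h3 (by positivity)).trans ?_
      gcongr
    linarith
  have hKinf : ¬ FiniteDimensional ℂ K := fun h => hPJ (qBH_finite J hJ0 K)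
  obtain ⟨u, v, huv⟩ := qBH_isometries hKinf
  obtain ⟨y, hy⟩ := qBH_leftInverse (e ∘L K.subtypeL) _ hε (fun k => hK1 k k.2)
  have hιι : ∀ k : K, K.orthogonalProjectionOnto (k : H) = k :=
    K.orthogonalProjectionOnto_mem_subspace_eq_self
  have hadj : ∀ (u : K →ₗᵢ[ℂ] K) (k : K), adjoint u.toContinuousLinearMap (u k) = k := by
    intro u k
    refine ext_inner_right ℂ fun w => ?_
    rw [adjoint_inner_left]
    exact u.inner_map_map k w
  have hadj0 : ∀ k : K, adjoint u.toContinuousLinearMap (v k) = 0 := by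
    intro k
    refine ext_inner_left ℂ fun w => ?_
    rw [adjoint_inner_right, inner_zero_right]
    exact huv w k
  let p : (K →ₗᵢ[ℂ] K) → (H →L[ℂ] H) := fun u =>
    K.subtypeL ∘L u.toContinuousLinearMap ∘L adjoint u.toContinuousLinearMap ∘L
      K.orthogonalProjectionOnto
  have hpa : ∀ u z, p u z = (u (adjoint u.toContinuousLinearMap (K.orthogonalProjectionOnto z)) : H) :=
    fun u z => rfl
  have hyp : ∀ u, (K.subtypeL ∘L y) * e * p u = p u := by
    intro u
    ext z
    simp only [qBH_mul_apply, hpa]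
    exact congrArg Subtype.val (hy _)
  have hpp : ∀ u, p u * p u = p u := by
    intro u
    ext z
    simp only [qBH_mul_apply, hpa, hιι, hadj]
  have hpJ : ∀ u, p u ∉ J := by
    intro u h
    apply hPJ
    have h1 := J.mul_mem_left (K.subtypeL ∘L adjoint u.toContinuousLinearMap ∘L
      K.orthogonalProjectionOnto) _ (J.mul_mem_right _ (K.subtypeL ∘L u.toContinuousLinearMap ∘L
      K.orthogonalProjectionOnto) h)
    convert h1 using 1
    ext z
    have hz : (K.subtypeL ∘L u.toContinuousLinearMap ∘L K.orthogonalProjectionOnto) z =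
      (u (K.orthogonalProjectionOnto z) : H) := rfl
    have hz' : ∀ z, (K.subtypeL ∘L adjoint u.toContinuousLinearMap ∘L
      K.orthogonalProjectionOnto) z =
      (adjoint u.toContinuousLinearMap (K.orthogonalProjectionOnto z) : H) := fun _ => rfl
    simp only [qBH_mul_apply, hz, hz', hpa, hιι, hadj]
    rfl
  refine qBH_algebra J e (K.subtypeL ∘L y) (p u) (p v) he he0 hmin (hyp u) (hyp v) (hpp u) (hpp v)
    ?_ (hpJ u) (hpJ v)
  ext z
  simp only [qBH_mul_apply, hpa, hιι, hadj0]
  simp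
end
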